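/- Let F_1, …, F_ℓ be Hamiltonian graphs, each 2-connected. Let G be any connected graph whose blocks are isomorphic to F_1, …, F_ℓ (a strict block-cut tree), and let G* be the graph obtained by letting all of F_1, …, F_ℓ share a single common vertex (a block-cut star). Then the matching number of G is at least the matching number of G*. -/

import Mathlib

/-- `B` induces a subgraph of `G` with no cut-vertex: removing any single vertex of `B` leaves the
induced graph preconnected. -/
def NoCutVertex {V : Type*} [DecidableEq V] (G : SimpleGraph V) (B : Finset V) : Prop :=
  ∀ v ∈ B, (G.induce ((B.erase v : Finset V) : Set V)).Preconnected

/-- `B` is (the vertex set of) a block of `G`: a maximal vertex subset inducing a connected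
subgraph with no cut-vertex. -/
def IsBlock {V : Type*} [DecidableEq V] (G : SimpleGraph V) (B : Finset V) : Prop :=
  B.Nonempty ∧ (G.induce (B : Set V)).Preconnected ∧ NoCutVertex G B ∧
    ∀ C : Finset V, B ⊆ C → (G.induce (C : Set V)).Preconnected → NoCutVertex G C → B = C

open SimpleGraph

section Reachability

variable {V : Type*} {G : SimpleGraph V}

/-- `a` and `b` are joined by a walk of `G` all of whose vertices lie in `S`. -/
def ReachableWithin (G : SimpleGraph V) (S : Set V) (a b : V) : Prop :=
  ∃ p : G.Walk a b, ∀ z ∈ p.support, z ∈ S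

theorem ReachableWithin.mono {S T : Set V} (hST : S ⊆ T) {a b : V} (h : ReachableWithin G S a b) :
    ReachableWithin G T a b :=
  let ⟨p, hp⟩ := h
  ⟨p, fun z hz => hST (hp z hz)⟩

theorem ReachableWithin.symm {S : Set V} {a b : V} (h : ReachableWithin G S a b) :
    ReachableWithin G S b a := by
  obtain ⟨p, hp⟩ := h
  exact ⟨p.reverse, fun z hz => hp z (by simpa using hz)⟩

theorem ReachableWithin.trans {S : Set V} {a b c : V} (h : ReachableWithin G S a b)
    (h' : ReachableWithin G S b c) : ReachableWithin G S a c := by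
  obtain ⟨p, hp⟩ := h
  obtain ⟨q, hq⟩ := h'
  refine ⟨p.append q, fun z hz => ?_⟩
  rcases (Walk.mem_support_append_iff _ _).1 hz with hz | hz
  exacts [hp z hz, hq z hz]

theorem preconnected_induce_of_reachableWithin {S : Set V} (c : V)
    (h : ∀ x ∈ S, ReachableWithin G S x c) :
    (G.induce S).Preconnected := by
  rintro ⟨a, ha⟩ ⟨b, hb⟩
  obtain ⟨p, hp⟩ := (h a ha).trans (h b hb).symm
  exact (p.induce S hp).reachable

theorem reachableWithin_of_preconnected_induce {S : Set V} (h : (G.induce S).Preconnected) {a b : V}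
    (ha : a ∈ S) (hb : b ∈ S) : ReachableWithin G S a b := by
  obtain ⟨p⟩ := h ⟨a, ha⟩ ⟨b, hb⟩
  refine ⟨p.map (Embedding.induce S).toHom, fun z hz => ?_⟩
  obtain ⟨y, -, rfl⟩ := List.mem_map.1 (Walk.support_map _ _ ▸ hz)
  exact y.2

end Reachability

section Blocks

variable {V : Type*} [DecidableEq V] {G : SimpleGraph V}

theorem IsBlock.reachableWithin {B : Finset V} (hB : IsBlock G B) {a b : V} (ha : a ∈ B)
    (hb : b ∈ B) : ReachableWithin G B a b :=
  reachableWithin_of_preconnected_induce hB.2.1 ha hb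

theorem IsBlock.reachableWithin_erase {B : Finset V} (hB : IsBlock G B) {a b x : V} (ha : a ∈ B)
    (hb : b ∈ B) (hax : a ≠ x) (hbx : b ≠ x) : ReachableWithin G (B.erase x : Finset V) a b := by
  by_cases hx : x ∈ B
  · exact reachableWithin_of_preconnected_induce (hB.2.2.1 x hx) (by simp [hax, ha])
      (by simp [hbx, hb])
  · rw [Finset.erase_eq_of_notMem hx]
    exact hB.reachableWithin ha hb

/-- Every vertex of a path other than `x` can reach one of the ends along the path
without meeting `x`. -/
theorem SimpleGraph.Walk.IsPath.reachableWithin_erase {b c : V} {P : G.Walk b c}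
    (hP : P.IsPath) {x y : V} (hy : y ∈ P.support) (hyx : y ≠ x) :
    ReachableWithin G (P.support.toFinset.erase x : Finset V) y b ∨
      ReachableWithin G (P.support.toFinset.erase x : Finset V) y c := by
  by_cases hx : x ∈ (P.takeUntil y hy).support
  · right
    refine ⟨P.dropUntil y hy, fun z hz => ?_⟩
    have hzP := P.support_dropUntil_subset_support hy hz
    suffices z ≠ x by simpa [this] using hzP
    rintro rfl
    have hnd := hP.support_nodup
    rw [← P.take_spec hy, Walk.support_append] at hnd
    rw [← Walk.cons_tail_support] at hz
    rcases List.mem_cons.1 hz with h | h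
    · exact hyx h.symm
    · exact List.disjoint_of_nodup_append hnd hx h
  · left
    refine ⟨(P.takeUntil y hy).reverse, fun z hz => ?_⟩
    rw [Walk.support_reverse, List.mem_reverse] at hz
    have hzP := P.support_takeUntil_subset_support hy hz
    have : z ≠ x := by rintro rfl; exact hx hz
    simpa [this] using hzP

/-- Two blocks sharing a vertex `v` and joined by a walk avoiding `v` coincide. -/
theorem IsBlock.eq_of_walk {B C : Finset V} (hB : IsBlock G B) (hC : IsBlock G C) {v b c : V}
    (hvB : v ∈ B) (hvC : v ∈ C) (hb : b ∈ B) (hc : c ∈ C) (Q : G.Walk b c)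
    (hvQ : v ∉ Q.support) : B = C := by
  obtain ⟨P, hP, hvP⟩ : ∃ P : G.Walk b c, P.IsPath ∧ v ∉ P.support :=
    ⟨Q.bypass, Q.bypass_isPath, fun h => hvQ (Q.support_bypass_subset_support h)⟩
  have hbv : b ≠ v := by rintro rfl; exact hvP P.start_mem_support
  have hcv : c ≠ v := by rintro rfl; exact hvP P.end_mem_support
  set D : Finset V := B ∪ C ∪ P.support.toFinset with hD
  have hBD : B ⊆ D := fun x hx => by simp [hD, hx]
  have hCD : C ⊆ D := fun x hx => by simp [hD, hx]
  have hPD : P.support.toFinset ⊆ D := fun x hx => by simp only [hD, Finset.mem_union, hx, or_true]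
  have herase {S : Finset V} (hS : S ⊆ D) (x : V) :
      ((S.erase x : Finset V) : Set V) ⊆ (D.erase x : Finset V) :=
    Finset.coe_subset.2 (Finset.erase_subset_erase x hS)
  have hconn : (G.induce (D : Set V)).Preconnected := by
    refine preconnected_induce_of_reachableWithin v fun y hy => ?_
    have hy' : (y ∈ B ∨ y ∈ C) ∨ y ∈ P.support := by simpa [hD, or_assoc] using hy
    rcases hy' with (hy | hy) | hy
    · exact (hB.reachableWithin hy hvB).mono (Finset.coe_subset.2 hBD)
    · exact (hC.reachableWithin hy hvC).mono (Finset.coe_subset.2 hCD)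
    · refine ReachableWithin.trans (b := b) ?_
        ((hB.reachableWithin hb hvB).mono (Finset.coe_subset.2 hBD))
      refine ⟨(P.takeUntil y hy).reverse, fun z hz => hPD ?_⟩
      rw [Walk.support_reverse, List.mem_reverse] at hz
      exact List.mem_toFinset.2 (P.support_takeUntil_subset_support hy hz)
  have hcut : NoCutVertex G D := by
    intro x _
    by_cases hxv : x = v
    · subst hxv
      have hcb : ReachableWithin G (D.erase x : Finset V) c b :=
        ReachableWithin.mono (herase hPD x) ⟨P.reverse, fun z hz => by
          have hz' : z ∈ P.support := by simpa using hz
          have : z ≠ x := by rintro rfl; exact hvP hz'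
          simp [this, hz']⟩
      refine preconnected_induce_of_reachableWithin b fun y hy => ?_
      have hy' : y ≠ x ∧ ((y ∈ B ∨ y ∈ C) ∨ y ∈ P.support) := by
        simpa [hD, or_assoc, and_comm] using hy
      obtain ⟨hyx, (hy | hy) | hy⟩ := hy'
      · exact (hB.reachableWithin_erase hy hb hyx hbv).mono (herase hBD x)
      · exact ((hC.reachableWithin_erase hy hc hyx hcv).mono (herase hCD x)).trans hcb
      · rcases hP.reachableWithin_erase hy hyx with h | h
        · exact h.mono (herase hPD x)
        · exact (h.mono (herase hPD x)).trans hcb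
    · refine preconnected_induce_of_reachableWithin v fun y hy => ?_
      have hy' : y ≠ x ∧ ((y ∈ B ∨ y ∈ C) ∨ y ∈ P.support) := by
        simpa [hD, or_assoc, and_comm] using hy
      have hvx : v ≠ x := Ne.symm hxv
      obtain ⟨hyx, (hy | hy) | hy⟩ := hy'
      · exact (hB.reachableWithin_erase hy hvB hyx hvx).mono (herase hBD x)
      · exact (hC.reachableWithin_erase hy hvC hyx hvx).mono (herase hCD x)
      · rcases hP.reachableWithin_erase hy hyx with h | h
        · have hbx : b ≠ x := by
            obtain ⟨p, hp⟩ := h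
            exact Finset.ne_of_mem_erase (hp b p.end_mem_support)
          exact (h.mono (herase hPD x)).trans
            ((hB.reachableWithin_erase hb hvB hbx hvx).mono (herase hBD x))
        · have hcx : c ≠ x := by
            obtain ⟨p, hp⟩ := h
            exact Finset.ne_of_mem_erase (hp c p.end_mem_support)
          exact (h.mono (herase hPD x)).trans
            ((hC.reachableWithin_erase hc hvC hcx hvx).mono (herase hCD x))
  exact (hB.2.2.2 D hBD hconn hcut).trans (hC.2.2.2 D hCD hconn hcut).symm

/-- A shortest walk from `a` to `r` avoids every other vertex at least as far from `r` as `a`. -/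
theorem SimpleGraph.Connected.exists_walk_notMem_support (hG : G.Connected) {a v r : V}
    (hle : G.dist a r ≤ G.dist v r) (hva : v ≠ a) : ∃ p : G.Walk a r, v ∉ p.support := by
  obtain ⟨p, hp⟩ := hG.exists_walk_length_eq_dist a r
  refine ⟨p, fun hv => hva ?_⟩
  have hlen := congrArg Walk.length (p.take_spec hv)
  rw [Walk.length_append] at hlen
  have hdrop := dist_le (p.dropUntil v hv)
  exact (Walk.eq_of_length_eq_zero (p := p.takeUntil v hv) (by omega)).symm

theorem IsBlock.eq_of_dist_le (hG : G.Connected) {B C : Finset V} (hB : IsBlock G B)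
    (hC : IsBlock G C) {b c v r : V} (hb : b ∈ B) (hc : c ∈ C) (hbr : G.dist b r ≤ G.dist v r)
    (hcr : G.dist c r ≤ G.dist v r) (hvB : v ∈ B) (hvC : v ∈ C) (hvb : v ≠ b) (hvc : v ≠ c) :
    B = C := by
  obtain ⟨p, hp⟩ := hG.exists_walk_notMem_support hbr hvb
  obtain ⟨q, hq⟩ := hG.exists_walk_notMem_support hcr hvc
  refine hB.eq_of_walk hC hvB hvC hb hc (p.append q.reverse) fun h => ?_
  rcases (Walk.mem_support_append_iff _ _).1 h with h | h
  · exact hp h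
  · exact hq (by simpa using h)

theorem exists_isBlock_superset [Fintype V] {A : Finset V} (hne : A.Nonempty)
    (hconn : (G.induce (A : Set V)).Preconnected) (hcut : NoCutVertex G A) :
    ∃ B, IsBlock G B ∧ A ⊆ B := by
  obtain ⟨B, hAB, hB⟩ := (Set.toFinite
    {C : Finset V | (G.induce (C : Set V)).Preconnected ∧ NoCutVertex G C}).exists_le_maximal
      (a := A) ⟨hconn, hcut⟩
  exact ⟨B, ⟨hne.mono hAB, hB.prop.1, hB.prop.2,
    fun C hBC h₁ h₂ => hB.eq_of_le ⟨h₁, h₂⟩ hBC⟩, hAB⟩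

theorem exists_isBlock_of_adj [Fintype V] {u v : V} (h : G.Adj u v) :
    ∃ B, IsBlock G B ∧ u ∈ B ∧ v ∈ B := by
  obtain ⟨B, hB, hsub⟩ := exists_isBlock_superset (G := G) (A := {u, v}) (by simp)
    (by
      refine preconnected_induce_of_reachableWithin v fun x hx => ?_
      have hx' : x = u ∨ x = v := by simpa using hx
      rcases hx' with rfl | rfl
      · exact ⟨h.toWalk, by simp⟩
      · exact ⟨Walk.nil, by simp⟩)
    (by
      intro x _
      have : (((({u, v} : Finset V).erase x : Finset V)) : Set V).Subsingleton := by
        intro a ha b hb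
        simp at ha hb
        grind
      rintro ⟨a, ha⟩ ⟨b, hb⟩
      obtain rfl := this ha hb
      rfl)
  exact ⟨B, hB, hsub (by simp), hsub (by simp)⟩

theorem exists_isBlock_mem [Fintype V] (G : SimpleGraph V) (v : V) :
    ∃ B, IsBlock G B ∧ v ∈ B := by
  obtain ⟨B, hB, hsub⟩ := exists_isBlock_superset (G := G) (A := {v}) (by simp)
    (preconnected_induce_of_reachableWithin v fun x hx => by
      obtain rfl : x = v := by simpa using hx
      exact ⟨Walk.nil, by simp⟩)
    (by
      rintro x hx ⟨a, ha⟩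
      simp at hx ha
      exact absurd (ha.1.trans hx.symm) ha.2)
  exact ⟨B, hB, hsub (by simp)⟩

end Blocks

section Matchings

variable {V : Type*} {G : SimpleGraph V}

/-- A path has a matching covering all its vertices but at most one. -/
theorem exists_isMatching_of_isChain (l : List V) (hl : l.IsChain G.Adj) (hnd : l.Nodup) :
    ∃ M : G.Subgraph, M.IsMatching ∧ M.verts ⊆ {x | x ∈ l} ∧
      M.verts.ncard = 2 * (l.length / 2) := by
  induction l using List.twoStepInduction with
  | nil => exact ⟨⊥, by simp [Subgraph.IsMatching], by simp, by simp⟩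
  | singleton a => exact ⟨⊥, by simp [Subgraph.IsMatching], by simp, by simp⟩
  | cons_cons a b l ih _ =>
    obtain ⟨hab, hl'⟩ := List.isChain_cons_cons.1 hl
    obtain ⟨M, hM, hsub, hcard⟩ := ih hl'.tail hnd.tail.tail
    have hdisj : Disjoint (G.subgraphOfAdj hab).verts M.verts := by
      rw [Set.disjoint_left]
      intro x hx hxM
      have := hsub hxM
      simp at hx this hnd
      grind
    refine ⟨G.subgraphOfAdj hab ⊔ M, .sup (.subgraphOfAdj hab) hM ?_, ?_, ?_⟩
    · exact hdisj.mono (Subgraph.support_subset_verts _) (Subgraph.support_subset_verts _)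
    · rintro x (hx | hx)
      · simp at hx ⊢
        tauto
      · have := hsub hx
        simp at this ⊢
        tauto
    · rw [Subgraph.verts_sup, Set.ncard_union_eq hdisj (by simp)
        ((List.finite_toSet l).subset hsub), hcard, subgraphOfAdj_verts, Set.ncard_pair hab.ne]
      simp
      omega

theorem exists_isMatching_ncard_eq_sum [Fintype V] {ι : Type*} [Fintype ι] (M : ι → G.Subgraph)
    (hM : ∀ i, (M i).IsMatching) (hd : Pairwise fun i j => Disjoint (M i).verts (M j).verts) :
    ∃ N : G.Subgraph, N.IsMatching ∧ N.verts.ncard = ∑ i, (M i).verts.ncard := by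
  refine ⟨⨆ i, M i, .iSup hM fun i j hij => (hd hij).mono (Subgraph.support_subset_verts _)
    (Subgraph.support_subset_verts _), ?_⟩
  rw [Subgraph.verts_iSup, Set.ncard_iUnion_of_finite (fun i => Set.toFinite _) hd,
    finsum_eq_sum_of_fintype]

theorem SimpleGraph.Subgraph.IsMatching.even_ncard [Finite V] {M : G.Subgraph}
    (hM : M.IsMatching) : Even M.verts.ncard := by
  classical
  have := Fintype.ofFinite V
  rw [Set.ncard_eq_toFinset_card']
  exact hM.even_card

variable [DecidableEq V]

theorem exists_isChain_of_isHamiltonian {B : Finset V} (h : (G.induce (B : Set V)).IsHamiltonian)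
    (hcard : 3 ≤ B.card) {v : V} (hv : v ∈ B) :
    ∃ l : List V, (l ++ [v]).IsChain G.Adj ∧ (l ++ [v]).Nodup ∧ (l ++ [v]).toFinset = B := by
  have : Nontrivial ((B : Finset V) : Set V) :=
    (Finset.one_lt_card_iff_nontrivial.1 (by omega : 1 < B.card)).coe_sort
  obtain ⟨p, hp⟩ := h.exists_isHamiltonianCycle ⟨v, hv⟩
  have hT := hp.isHamiltonian_tail
  let q := p.tail.map (Embedding.induce (B : Set V)).toHom
  have hlast : q.support = q.support.dropLast ++ [v] := by
    conv_lhs => rw [← List.dropLast_append_getLast q.support_ne_nil, q.getLast_support]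
    rfl
  refine ⟨q.support.dropLast, ?_, ?_, ?_⟩
  · rw [← hlast]
    exact q.isChain_adj_support
  · rw [← hlast]
    exact (hT.isPath.map (f := (Embedding.induce (B : Set V)).toHom)
      Subtype.val_injective).support_nodup
  · rw [← hlast]
    ext x
    rw [List.mem_toFinset, Walk.support_map, List.mem_map]
    exact ⟨fun ⟨y, _, hy⟩ => hy ▸ y.2, fun hx => ⟨⟨x, hx⟩, hT.mem_support _, rfl⟩⟩

theorem exists_isMatching_sdiff_of_isHamiltonian {B : Finset V}
    (h : (G.induce (B : Set V)).IsHamiltonian) (hcard : 3 ≤ B.card) {v : V} (hv : v ∈ B) :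
    ∃ M : G.Subgraph, M.IsMatching ∧ M.verts ⊆ (B : Set V) \ {v} ∧
      M.verts.ncard = 2 * ((B.card - 1) / 2) := by
  obtain ⟨l, hl, hnd, hB⟩ := exists_isChain_of_isHamiltonian h hcard hv
  obtain ⟨M, hM, hsub, hc⟩ := exists_isMatching_of_isChain l hl.left_of_append
    (List.Nodup.of_append_left hnd)
  have hlen : B.card = l.length + 1 := by
    rw [← hB, List.toFinset_card_of_nodup hnd]
    simp
  refine ⟨M, hM, fun x hx => ?_, by rw [hc, hlen]; simp⟩
  have hxl : x ∈ l := hsub hx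
  refine ⟨by simp [← hB, hxl], ?_⟩
  rintro rfl
  exact List.disjoint_of_nodup_append hnd hxl (by simp)

theorem exists_isMatching_of_isHamiltonian {B : Finset V}
    (h : (G.induce (B : Set V)).IsHamiltonian) (hcard : 3 ≤ B.card) :
    ∃ M : G.Subgraph, M.IsMatching ∧ M.verts ⊆ (B : Set V) ∧
      M.verts.ncard = 2 * (B.card / 2) := by
  obtain ⟨v, hv⟩ : B.Nonempty := Finset.card_pos.1 (by omega)
  obtain ⟨l, hl, hnd, hB⟩ := exists_isChain_of_isHamiltonian h hcard hv
  obtain ⟨M, hM, hsub, hc⟩ := exists_isMatching_of_isChain _ hl hnd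
  refine ⟨M, hM, fun x hx => ?_, by rw [hc, ← hB, List.toFinset_card_of_nodup hnd]⟩
  rw [← hB]
  exact List.mem_toFinset.2 (hsub hx)

/-- A matching matches an even number of vertices of `C` other than `w` among themselves. -/
theorem SimpleGraph.Subgraph.IsMatching.ncard_inner_le [Finite V] {M : G.Subgraph}
    (hM : M.IsMatching) {C : Finset V} {w : V} (hw : w ∈ C) :
    {x | ∃ y, M.Adj x y ∧ x ∈ C.erase w ∧ y ∈ C.erase w}.ncard ≤ 2 * ((C.card - 1) / 2) := by
  set S := {x | ∃ y, M.Adj x y ∧ x ∈ C.erase w ∧ y ∈ C.erase w} with hS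
  have hmatch : (M.induce S).IsMatching := by
    rintro x ⟨y, hxy, hx, hy⟩
    refine ⟨y, ⟨⟨y, hxy, hx, hy⟩, ⟨x, hxy.symm, hy, hx⟩, hxy⟩, ?_⟩
    rintro z ⟨-, -, hz⟩
    exact hM.eq_of_adj_left hz hxy
  have heven : Even S.ncard := hmatch.even_ncard
  have hle : S.ncard ≤ (C.erase w).card := by
    rw [← Set.ncard_coe_finset]
    exact Set.ncard_le_ncard (fun x ⟨_, _, hx, _⟩ => hx) (Set.toFinite _)
  rw [Finset.card_erase_of_mem hw] at hle
  obtain ⟨k, hk⟩ := heven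
  omega

end Matchings

section Bounds

open scoped Classical in
/-- In a connected graph whose blocks are Hamiltonian, the matchings of the blocks that avoid one
vertex of each block can be combined; one even block can moreover be matched perfectly. -/
theorem exists_isMatching_ge_sum_isBlock {V : Type*} [Fintype V] [DecidableEq V]
    {G : SimpleGraph V} (hG : G.Connected)
    (hham : ∀ B : Finset V, IsBlock G B → (G.induce (B : Set V)).IsHamiltonian ∧ 3 ≤ B.card) :
    ∃ M : G.Subgraph, M.IsMatching ∧
      (∑ B : {B : Finset V // IsBlock G B}, 2 * ((B.1.card - 1) / 2)) +
        (if ∃ B : {B : Finset V // IsBlock G B}, Even B.1.card then 2 else 0) ≤ M.verts.ncard := by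
  have hgate (r : V) (B : {B : Finset V // IsBlock G B}) :
      ∃ b ∈ B.1, ∀ v ∈ B.1, G.dist b r ≤ G.dist v r :=
    Finset.exists_min_image B.1 (fun v => G.dist v r) B.2.1
  split_ifs with heven
  · obtain ⟨R, hR⟩ := heven
    obtain ⟨r, hr⟩ := R.2.1
    choose p hp hmin using hgate r
    have hpr : ∀ B : {B : Finset V // IsBlock G B}, r ∈ B.1 → p B = r := fun B hB => by
      have := hmin B r hB
      rw [dist_self, Nat.le_zero] at this
      exact (hG.dist_eq_zero_iff).1 this
    have hM (B : {B : Finset V // IsBlock G B}) : ∃ M : G.Subgraph, M.IsMatching ∧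
        (M.verts ⊆ if B = R then (B.1 : Set V) else (B.1 : Set V) \ {p B}) ∧
        M.verts.ncard = 2 * ((B.1.card - 1) / 2) + if B = R then 2 else 0 := by
      split_ifs with h
      · subst h
        obtain ⟨M, h₁, h₂, h₃⟩ := exists_isMatching_of_isHamiltonian (hham B.1 B.2).1
          (hham B.1 B.2).2
        refine ⟨M, h₁, h₂, ?_⟩
        have := (hham B.1 B.2).2
        obtain ⟨k, hk⟩ := hR
        omega
      · exact exists_isMatching_sdiff_of_isHamiltonian (hham B.1 B.2).1 (hham B.1 B.2).2 (hp B)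
    choose M hM hsub hcard using hM
    have hcore (B C : {B : Finset V // IsBlock G B}) (hCR : C ≠ R) (hBC : B ≠ C) (v : V)
        (hvB : v ∈ (M B).verts) : v ∉ (M C).verts := by
      intro hvC
      have hC := hsub C hvC
      rw [if_neg hCR] at hC
      have hB : v ∈ B.1 := by
        have := hsub B hvB
        split_ifs at this
        exacts [this, this.1]
      by_cases hvp : v = p B
      · have hBR : B = R := by
          by_contra hne
          have := hsub B hvB
          rw [if_neg hne] at this
          exact this.2 hvp
        subst hBR
        rw [hpr B hr] at hvp
        subst hvp
        exact hC.2 (hpr C hC.1).symm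
      · exact hBC (Subtype.ext (B.2.eq_of_dist_le hG C.2 (hp B) (hp C) (hmin B v hB)
          (hmin C v hC.1) hB hC.1 hvp hC.2))
    obtain ⟨N, hN, hNc⟩ := exists_isMatching_ncard_eq_sum M hM fun B C hBC => by
      refine Set.disjoint_left.2 ?_
      intro v hvB hvC
      by_cases hCR : C = R
      · exact hcore C B (fun h => hBC (h.trans hCR.symm)) hBC.symm v hvC hvB
      · exact hcore B C hCR hBC v hvB hvC
    refine ⟨N, hN, ?_⟩
    rw [hNc, Finset.sum_congr rfl fun B _ => hcard B, Finset.sum_add_distrib]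
    simp
  · obtain ⟨r⟩ := hG.nonempty
    choose p hp hmin using hgate r
    choose M hM hsub hcard using fun B : {B : Finset V // IsBlock G B} =>
      exists_isMatching_sdiff_of_isHamiltonian (hham B.1 B.2).1 (hham B.1 B.2).2 (hp B)
    obtain ⟨N, hN, hNc⟩ := exists_isMatching_ncard_eq_sum M hM fun B C hBC => by
      refine Set.disjoint_left.2 ?_
      intro v hvB hvC
      have hB := hsub B hvB
      have hC := hsub C hvC
      exact hBC (Subtype.ext (B.2.eq_of_dist_le hG C.2 (hp B) (hp C) (hmin B v hB.1)
        (hmin C v hC.1) hB.1 hC.1 hB.2 hC.2))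
    refine ⟨N, hN, ?_⟩
    rw [hNc, Finset.sum_congr rfl fun B _ => hcard B]
    simp

open scoped Classical in
/-- Matchings of a block-cut star cover at most what a matching of each block minus the centre can
cover, plus two vertices if there is an even block. -/
theorem SimpleGraph.Subgraph.IsMatching.ncard_le_sum_isBlock {W : Type*} [Fintype W]
    [DecidableEq W] {G : SimpleGraph W} {w : W} (hw : ∀ C : Finset W, IsBlock G C → w ∈ C)
    {M : G.Subgraph} (hM : M.IsMatching) :
    M.verts.ncard ≤ (∑ C : {C : Finset W // IsBlock G C}, 2 * ((C.1.card - 1) / 2)) +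
      (if ∃ C : {C : Finset W // IsBlock G C}, Even C.1.card then 2 else 0) := by
  split_ifs with heven
  · let S (C : {C : Finset W // IsBlock G C}) : Set W :=
      {x | ∃ y, M.Adj x y ∧ x ∈ C.1.erase w ∧ y ∈ C.1.erase w}
    have hunion : (⋃ C, S C).ncard ≤
        ∑ C : {C : Finset W // IsBlock G C}, 2 * ((C.1.card - 1) / 2) :=
      (Set.ncard_iUnion_le_of_fintype S).trans
        (Finset.sum_le_sum fun C _ => hM.ncard_inner_le (hw C.1 C.2))
    have hrest : {x | x ∈ M.verts ∧ (x = w ∨ M.Adj w x)}.ncard ≤ 2 := by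
      by_cases h : ∃ u, M.Adj w u
      · obtain ⟨u, hu⟩ := h
        refine (Set.ncard_le_ncard (t := {w, u}) ?_ (Set.toFinite _)).trans
          ((Set.ncard_insert_le _ _).trans (by simp))
        rintro x ⟨-, rfl | hx⟩
        · simp
        · simp [hM.eq_of_adj_left hx hu]
      · refine (Set.ncard_le_ncard (t := {w}) ?_ (Set.toFinite _)).trans (by simp)
        rintro x ⟨-, rfl | hx⟩
        · simp
        · exact absurd ⟨x, hx⟩ h
    have hcover : M.verts ⊆ (⋃ C, S C) ∪ {x | x ∈ M.verts ∧ (x = w ∨ M.Adj w x)} := by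
      intro x hx
      by_cases hxw : x = w ∨ M.Adj w x
      · exact Or.inr ⟨hx, hxw⟩
      · left
        push Not at hxw
        obtain ⟨y, hxy, -⟩ := hM hx
        obtain ⟨C, hC, hxC, hyC⟩ := exists_isBlock_of_adj hxy.adj_sub
        have hyw : y ≠ w := by
          rintro rfl
          exact hxw.2 hxy.symm
        exact Set.mem_iUnion.2 ⟨⟨C, hC⟩, y, hxy, by simp [hxw.1, hxC], by simp [hyw, hyC]⟩
    calc M.verts.ncard
        ≤ ((⋃ C, S C) ∪ {x | x ∈ M.verts ∧ (x = w ∨ M.Adj w x)}).ncard :=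
          Set.ncard_le_ncard hcover (Set.toFinite _)
      _ ≤ _ := Set.ncard_union_le _ _
      _ ≤ _ := add_le_add hunion hrest
  · push Not at heven
    have hcover : M.verts ⊆ {w} ∪ ⋃ C : {C : Finset W // IsBlock G C}, (C.1.erase w : Set W) := by
      intro x _
      obtain ⟨C, hC, hx⟩ := exists_isBlock_mem G x
      by_cases hxw : x = w
      · exact Or.inl hxw
      · exact Or.inr (Set.mem_iUnion.2 ⟨⟨C, hC⟩, by simp [hxw, hx]⟩)
    have hle : M.verts.ncard ≤
        1 + ∑ C : {C : Finset W // IsBlock G C}, 2 * ((C.1.card - 1) / 2) := by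
      refine (Set.ncard_le_ncard hcover (Set.toFinite _)).trans ((Set.ncard_union_le _ _).trans ?_)
      rw [Set.ncard_singleton]
      refine Nat.add_le_add_left ((Set.ncard_iUnion_le_of_fintype _).trans
        (Finset.sum_le_sum fun C _ => ?_)) 1
      rw [Set.ncard_coe_finset, Finset.card_erase_of_mem (hw C.1 C.2)]
      obtain ⟨k, hk⟩ := Nat.not_even_iff_odd.1 (heven C)
      omega
    obtain ⟨k, hk⟩ := hM.even_ncard
    rw [← Finset.mul_sum] at hle ⊢
    omega

end Bounds

/-- If `G` is a connected graph (a strict block-cut tree) all of whose blocks are 2-connected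
Hamiltonian graphs, and `G*` is a connected graph with the same multiset of blocks all sharing a
single common vertex (a block-cut star), then `ν(G) ≥ ν(G*)`. -/
theorem stmt_7 {V W : Type*} [Fintype V] [DecidableEq V] [Fintype W] [DecidableEq W]
    (G : SimpleGraph V) (Gstar : SimpleGraph W)
    (hG : G.Connected) (hGstar : Gstar.Connected)
    -- every block of `G` is a 2-connected Hamiltonian graph
    (hham : ∀ B : Finset V, IsBlock G B → (G.induce (B : Set V)).IsHamiltonian ∧ 3 ≤ B.card)
    -- `G` and `G*` have the same blocks up to isomorphism
    (e : {B : Finset V // IsBlock G B} ≃ {C : Finset W // IsBlock Gstar C})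
    (hiso : ∀ B : {B : Finset V // IsBlock G B},
      Nonempty ((G.induce ((B : Finset V) : Set V)) ≃g
        (Gstar.induce (((e B : Finset W)) : Set W))))
    -- `G*` is a block-cut star: all of its blocks share one common vertex
    (hstar : ∃ w : W, ∀ C : Finset W, IsBlock Gstar C → w ∈ C) :
    ∀ Mstar : Gstar.Subgraph, Mstar.IsMatching →
      ∃ M : G.Subgraph, M.IsMatching ∧ Mstar.verts.ncard ≤ M.verts.ncard := by
  classical
  intro Mstar hMstar
  obtain ⟨w, hw⟩ := hstar
  obtain ⟨M, hM, hle⟩ := exists_isMatching_ge_sum_isBlock hG hham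
  refine ⟨M, hM, (hMstar.ncard_le_sum_isBlock hw).trans (le_trans (le_of_eq ?_) hle)⟩
  have hcard (B : {B : Finset V // IsBlock G B}) : (e B).1.card = B.1.card := by
    obtain ⟨f⟩ := hiso B
    simpa using (Nat.card_congr f.toEquiv).symm
  congr 1
  · rw [← e.sum_comp]
    simp only [hcard]
  · refine if_congr ?_ rfl rfl
    rw [← e.exists_congr_right]
    simp only [hcard]
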